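/- The Ricci curvature of the full connection of a generalised pp-wave with purely axial torsion, Ric_{λν} := R[Γ]^μ_{λμν}, equals ½ (∂₁²f + ∂₂²f − k(x³)²) l_λ l_ν; that is, its only nonzero component is Ric₃₃ = ½ (∂₁²f + ∂₂²f − k(x³)²). -/

import Mathlib

noncomputable section

open scoped BigOperators

/-- Points of spacetime: ℝ⁴ with coordinates x⁰, x¹, x², x³. -/
abbrev Spacetime := Fin 4 → ℝ

/-- Partial derivative ∂_μ of a scalar function. -/
def pd (μ : Fin 4) (h : Spacetime → ℝ) : Spacetime → ℝ :=
  fun x => fderiv ℝ h x (Pi.single μ 1)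

/-- The pp-metric g_{μν}: nonzero components g₀₃ = g₃₀ = 1, g₁₁ = g₂₂ = −1, g₃₃ = f. -/
def ppMetric (f : Spacetime → ℝ) (x : Spacetime) (μ ν : Fin 4) : ℝ :=
  if μ = 0 ∧ ν = 3 then 1 else if μ = 3 ∧ ν = 0 then 1
  else if μ = 1 ∧ ν = 1 then -1 else if μ = 2 ∧ ν = 2 then -1
  else if μ = 3 ∧ ν = 3 then f x else 0

/-- The pointwise inverse metric g^{μν}: g⁰⁰ = −f, g⁰³ = g³⁰ = 1, g¹¹ = g²² = −1. -/
def ppMetricInv (f : Spacetime → ℝ) (x : Spacetime) (μ ν : Fin 4) : ℝ :=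
  if μ = 0 ∧ ν = 0 then -(f x) else if μ = 0 ∧ ν = 3 then 1
  else if μ = 3 ∧ ν = 0 then 1
  else if μ = 1 ∧ ν = 1 then -1 else if μ = 2 ∧ ν = 2 then -1 else 0

/-- Christoffel symbols {Γ}^λ_{μν} = ½ g^{λκ}(∂_μ g_{κν} + ∂_ν g_{κμ} − ∂_κ g_{μν}). -/
def christoffel (f : Spacetime → ℝ) (x : Spacetime) (l μ ν : Fin 4) : ℝ :=
  (1/2) * ∑ κ, ppMetricInv f x l κ *
    (pd μ (fun y => ppMetric f y κ ν) x + pd ν (fun y => ppMetric f y κ μ) x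
      - pd κ (fun y => ppMetric f y μ ν) x)

/-- Totally antisymmetric symbol ε with ε₀₁₂₃ = 1. -/
def eps (a b c d : Fin 4) : ℝ :=
  ((((b:ℕ):ℝ) - ((a:ℕ):ℝ)) * (((c:ℕ):ℝ) - ((a:ℕ):ℝ)) * (((d:ℕ):ℝ) - ((a:ℕ):ℝ)) *
    (((c:ℕ):ℝ) - ((b:ℕ):ℝ)) * (((d:ℕ):ℝ) - ((b:ℕ):ℝ)) * (((d:ℕ):ℝ) - ((c:ℕ):ℝ))) / 12

/-- Purely axial torsion T_{κμν} = k(x³) ε_{0κμν}. -/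
def torsion (k : ℝ → ℝ) (x : Spacetime) (κ μ ν : Fin 4) : ℝ :=
  k (x 3) * eps 0 κ μ ν

/-- Contorsion K^κ_{μν} = ½ g^{κρ} T_{ρμν}. -/
def contorsion (f : Spacetime → ℝ) (k : ℝ → ℝ) (x : Spacetime) (κ μ ν : Fin 4) : ℝ :=
  (1/2) * ∑ ρ, ppMetricInv f x κ ρ * torsion k x ρ μ ν

/-- The full connection Γ^λ_{μν} = {Γ}^λ_{μν} + K^λ_{μν}. -/
def fullConn (f : Spacetime → ℝ) (k : ℝ → ℝ) (x : Spacetime) (κ μ ν : Fin 4) : ℝ :=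
  christoffel f x κ μ ν + contorsion f k x κ μ ν

/-- Curvature R[A]^κ_{λμν} of connection coefficients A^κ_{μν}. -/
def curv (A : Spacetime → Fin 4 → Fin 4 → Fin 4 → ℝ) (x : Spacetime)
    (κ l μ ν : Fin 4) : ℝ :=
  pd μ (fun y => A y κ ν l) x - pd ν (fun y => A y κ μ l) x
    + ∑ η, (A x κ μ η * A x η ν l - A x κ ν η * A x η μ l)

/-- The parallel null vector field l^μ = (1,0,0,0). -/
def lUp : Fin 4 → ℝ := fun μ => if μ = 0 then 1 else 0

/-- The lowered vector l_μ = g_{μν} l^ν = (0,0,0,1). -/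
def lCov : Fin 4 → ℝ := fun μ => if μ = 3 then 1 else 0

/-- Ricci curvature of the full connection: Ric_{λν} = R[Γ]^μ_{λμν}. -/
def RicFull (f : Spacetime → ℝ) (k : ℝ → ℝ) (x : Spacetime) (lam ν : Fin 4) : ℝ :=
  ∑ μ, curv (fullConn f k) x μ lam μ ν

theorem pd_const (μ : Fin 4) (c : ℝ) (x : Spacetime) : pd μ (fun _ => c) x = 0 := by
  simp [pd]

theorem pd_div_const (μ : Fin 4) (h : Spacetime → ℝ) (c : ℝ) (x : Spacetime) :
    pd μ (fun y => h y / c) x = pd μ h x / c := by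
  have e : (fun y => h y / c) = c⁻¹ • h := by
    funext y
    simp [div_eq_inv_mul]
  unfold pd
  rw [e, fderiv_const_smul_field]
  simp [div_eq_inv_mul]

theorem pd_neg (μ : Fin 4) (h : Spacetime → ℝ) (x : Spacetime) :
    pd μ (fun y => -h y) x = -pd μ h x := by
  simp [pd, fderiv_fun_neg]

theorem pd_comp_coord_of_ne {k : ℝ → ℝ} (hk : Differentiable ℝ k) {i μ : Fin 4} (hμ : μ ≠ i)
    (x : Spacetime) : pd μ (fun y => k (y i)) x = 0 := by
  have h₁ : HasFDerivAt (fun y : Spacetime => y i)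
      (ContinuousLinearMap.proj (R := ℝ) (φ := fun _ : Fin 4 => ℝ) i) x :=
    (ContinuousLinearMap.proj (R := ℝ) (φ := fun _ : Fin 4 => ℝ) i).hasFDerivAt
  have h₂ := (hk (x i)).hasDerivAt.comp_hasFDerivAt x h₁
  have h₃ : fderiv ℝ (fun y : Spacetime => k (y i)) x = _ := h₂.fderiv
  simp [pd, h₃, hμ.symm]

/-- Partial derivatives of a smooth function commute. -/
theorem pd_comm {f : Spacetime → ℝ} (hf : ContDiff ℝ (⊤ : ℕ∞) f) (μ ν : Fin 4) (x : Spacetime) :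
    pd μ (pd ν f) x = pd ν (pd μ f) x := by
  have hf₂ : ContDiff ℝ 2 f := contDiff_infty.1 hf 2
  have hd : DifferentiableAt ℝ (fderiv ℝ f) x :=
    (hf₂.fderiv_right (m := 1)
      one_add_one_eq_two.le).differentiable one_ne_zero x
  have e (a b : Fin 4) : pd a (pd b f) x =
      fderiv ℝ (fderiv ℝ f) x (Pi.single a 1) (Pi.single b 1) := by
    unfold pd
    rw [fderiv_clm_apply hd (differentiableAt_const _)]
    simp
  rw [e, e]
  exact (hf₂.contDiffAt.isSymmSndFDerivAt (by simp)) _ _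

theorem pd_pd_of_pd_eq_zero {f : Spacetime → ℝ} (hf : ContDiff ℝ (⊤ : ℕ∞) f) {μ : Fin 4}
    (h : ∀ x, pd μ f x = 0) (ν : Fin 4) (x : Spacetime) : pd μ (pd ν f) x = 0 := by
  rw [pd_comm hf, funext h]
  exact pd_const ν 0 x

theorem pd_ppMetric (f : Spacetime → ℝ) (μ a b : Fin 4) (x : Spacetime) :
    pd μ (fun y => ppMetric f y a b) x = if a = 3 ∧ b = 3 then pd μ f x else 0 := by
  fin_cases a <;> fin_cases b <;> simp [ppMetric, pd_const]

/-- The components `Γ^κ_{μν}` of the full connection when `∂₀f = 0`, in terms of the gradient `a`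
of `f` and the value `t` of `k`. -/
def connTable (a : Fin 4 → ℝ) (t : ℝ) : Fin 4 → Fin 4 → Fin 4 → ℝ :=
  ![![![0, 0, 0, 0], ![0, 0, t / 2, a 1 / 2], ![0, -(t / 2), 0, a 2 / 2],
      ![0, a 1 / 2, a 2 / 2, a 3 / 2]],
    ![![0, 0, 0, 0], ![0, 0, 0, 0], ![0, 0, 0, -(t / 2)], ![0, 0, t / 2, a 1 / 2]],
    ![![0, 0, 0, 0], ![0, 0, 0, t / 2], ![0, 0, 0, 0], ![0, -(t / 2), 0, a 2 / 2]],
    ![![0, 0, 0, 0], ![0, 0, 0, 0], ![0, 0, 0, 0], ![0, 0, 0, 0]]]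

theorem fullConn_eq_connTable {f : Spacetime → ℝ} (h0 : ∀ x, pd 0 f x = 0) (k : ℝ → ℝ)
    (x : Spacetime) (κ μ ν : Fin 4) :
    fullConn f k x κ μ ν = connTable (fun i => pd i f x) (k (x 3)) κ μ ν := by
  simp only [fullConn, christoffel, contorsion, torsion, pd_ppMetric, Fin.sum_univ_four]
  fin_cases κ <;> fin_cases μ <;> fin_cases ν <;>
    simp [ppMetricInv, eps, connTable, h0]
  all_goals ring

/-- Ric_{λν} = ½ (∂₁²f + ∂₂²f − k(x³)²) l_λ l_ν. -/
theorem full_ricci_formula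
    (f : Spacetime → ℝ) (hf : ContDiff ℝ (⊤ : ℕ∞) f) (h0 : ∀ x, pd 0 f x = 0)
    (k : ℝ → ℝ) (hk : ContDiff ℝ (⊤ : ℕ∞) k) :
    ∀ (x : Spacetime) (lam ν : Fin 4),
      RicFull f k x lam ν =
        (1/2) * (pd 1 (pd 1 f) x + pd 2 (pd 2 f) x - (k (x 3))^2) * lCov lam * lCov ν := by
  intro x lam ν
  have hkd : Differentiable ℝ k := hk.differentiable (by simp)
  have h00 := pd_pd_of_pd_eq_zero hf h0
  have hk0 := pd_comp_coord_of_ne hkd (i := 3) (μ := 0) (by decide) x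
  have hk1 := pd_comp_coord_of_ne hkd (i := 3) (μ := 1) (by decide) x
  have hk2 := pd_comp_coord_of_ne hkd (i := 3) (μ := 2) (by decide) x
  simp only [RicFull, curv, fullConn_eq_connTable h0, Fin.sum_univ_four]
  fin_cases lam <;> fin_cases ν <;>
    simp [connTable, lCov, pd_const, pd_neg, pd_div_const, h00, hk0, hk1, hk2]
  all_goals ring
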